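/- (Lemma 1 of the paper.) Let n ≥ 1, let w : Fin n → Fin n → EReal be edge lengths with no negative cycles, and let [u₀, u₁, …, u_l] be a shortest path with respect to w (a walk whose w-length equals dist_w(u₀, u_l) and, for every 0 ≤ a ≤ c ≤ l, the sub-walk u_a, …, u_c has w-length dist_w(u_a,u_c)). Suppose indices 0 ≤ a < c ≤ l satisfy u_a > u_b and u_c > u_b (as elements of Fin n) for all b with a < b < c. Run the IJK algorithm once starting from d = w; then in the matrix obtained after completing all outer-loop iterations i = 0, 1, …, u_a (i.e., the prefix of the IJK fold consisting of all update triples (i,j,k) with i ≤ u_a), the entry at (u_a, u_c) equals the shortest path distance dist_w(u_a, u_c). -/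

import Mathlib

open scoped BigOperators

noncomputable section

/-- The total `d`-length of a walk, given as the list of visited vertices.
A walk visiting at most one vertex has length `0`. -/
def walkLen {n : ℕ} (d : Fin n → Fin n → EReal) : List (Fin n) → EReal
  | [] => 0
  | [_] => 0
  | a :: b :: rest => d a b + walkLen d (b :: rest)

/-- Shortest-path distance from `s` to `t`: the infimum of walk lengths over all
finite walks from `s` to `t` (the empty walk `[s]` from `s` to `s` has length `0`). -/
def distW {n : ℕ} (d : Fin n → Fin n → EReal) (s t : Fin n) : EReal :=
  sInf {c : EReal | ∃ u : List (Fin n),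
    u.head? = some s ∧ u.getLast? = some t ∧ walkLen d u = c}

/-- No negative cycles: every closed walk has nonnegative total length. -/
def NoNegCycle {n : ℕ} (w : Fin n → Fin n → EReal) : Prop :=
  ∀ (u : List (Fin n)) (v : Fin n),
    u.head? = some v → u.getLast? = some v → 0 ≤ walkLen w u

/-- The relaxation update `d[i,j] ← min (d[i,j]) (d[i,k] + d[k,j])`,
leaving all other entries unchanged. -/
def upd {n : ℕ} (d : Fin n → Fin n → EReal) (i j k : Fin n) :
    Fin n → Fin n → EReal :=
  fun x y => if x = i ∧ y = j then min (d i j) (d i k + d k j) else d x y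

/-- All triples of `Fin n` in lexicographic order. -/
def triplesLex (n : ℕ) : List (Fin n × Fin n × Fin n) :=
  (List.finRange n).flatMap fun a =>
    (List.finRange n).flatMap fun b =>
      (List.finRange n).map fun c => (a, b, c)

/-- One run of the IJK algorithm: the triples `(i, j, k)` are processed in
lexicographic order of `(i, j, k)`, updating `d[i,j] ← min (d[i,j]) (d[i,k] + d[k,j])`. -/
def runIJK {n : ℕ} (d : Fin n → Fin n → EReal) : Fin n → Fin n → EReal :=
  (triplesLex n).foldl (fun d t => upd d t.1 t.2.1 t.2.2) d

/-- One run of the IKJ algorithm: the triples `(i, k, j)` are processed in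
lexicographic order of `(i, k, j)`, updating `d[i,j] ← min (d[i,j]) (d[i,k] + d[k,j])`. -/
def runIKJ {n : ℕ} (d : Fin n → Fin n → EReal) : Fin n → Fin n → EReal :=
  (triplesLex n).foldl (fun d t => upd d t.1 t.2.2 t.2.1) d

/-- One run of the (correct) KIJ Floyd–Warshall algorithm: the triples `(k, i, j)` are
processed in lexicographic order of `(k, i, j)`,
updating `d[i,j] ← min (d[i,j]) (d[i,k] + d[k,j])`. -/
def runKIJ {n : ℕ} (d : Fin n → Fin n → EReal) : Fin n → Fin n → EReal :=
  (triplesLex n).foldl (fun d t => upd d t.2.1 t.2.2 t.1) d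

/-- The partial run of the IJK algorithm consisting of all update triples `(i, j, k)`
with `i ≤ m`, in lexicographic order. -/
def runIJKUpto {n : ℕ} (m : Fin n) (d : Fin n → Fin n → EReal) :
    Fin n → Fin n → EReal :=
  ((triplesLex n).filter (fun t => decide (t.1 ≤ m))).foldl
    (fun d t => upd d t.1 t.2.1 t.2.2) d

/-- The partial run of the IKJ algorithm consisting of all update triples `(i, k, j)`
with `i ≤ m`, in lexicographic order. -/
def runIKJUpto {n : ℕ} (m : Fin n) (d : Fin n → Fin n → EReal) :
    Fin n → Fin n → EReal :=
  ((triplesLex n).filter (fun t => decide (t.1 ≤ m))).foldl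
    (fun d t => upd d t.1 t.2.2 t.2.1) d

/-- The `d`-length of the portion `u_a, u_{a+1}, …, u_c` of the vertex sequence `u`. -/
def pathLen {n : ℕ} (d : Fin n → Fin n → EReal) (u : ℕ → Fin n) (a c : ℕ) : EReal :=
  ∑ p ∈ Finset.Ico a c, d (u p) (u (p + 1))

/-- `u_0, …, u_l` is a shortest path w.r.t. `w`: every sub-walk `u_a, …, u_c`
has `w`-length equal to the shortest-path distance from `u_a` to `u_c`. -/
def IsShortestPath {n : ℕ} (w : Fin n → Fin n → EReal) (u : ℕ → Fin n) (l : ℕ) : Prop :=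
  ∀ a c, a ≤ c → c ≤ l → pathLen w u a c = distW w (u a) (u c)

section FoldIJK

variable {n : ℕ}

/-- The strict lexicographic order on index triples. -/
def LexLT (s t : Fin n × Fin n × Fin n) : Prop :=
  s.1 < t.1 ∨ s.1 = t.1 ∧ (s.2.1 < t.2.1 ∨ s.2.1 = t.2.1 ∧ s.2.2 < t.2.2)

/-- The matrix obtained from `d` by the IJK updates over the triples in `L`. -/
def foldIJK (L : List (Fin n × Fin n × Fin n)) (d : Fin n → Fin n → EReal) :
    Fin n → Fin n → EReal :=
  L.foldl (fun d t => upd d t.1 t.2.1 t.2.2) d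

/-- Every entry of the list is preceded by all lexicographically smaller triples. -/
def LexInitial (L : List (Fin n × Fin n × Fin n)) : Prop :=
  ∀ A t B, L = A ++ t :: B → ∀ s, LexLT s t → s ∈ A

lemma LexInitial.of_append {A B : List (Fin n × Fin n × Fin n)} (h : LexInitial (A ++ B)) :
    LexInitial A := by
  rintro A₁ t A₂ rfl s hs
  exact h A₁ t (A₂ ++ B) (by simp) s hs

lemma pairwise_lexLT_triplesLex : (triplesLex n).Pairwise LexLT := by
  have hlt : (List.finRange n).Pairwise (· < ·) := List.pairwise_lt_finRange n
  unfold triplesLex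
  refine List.pairwise_flatMap.2 ⟨fun a _ => List.pairwise_flatMap.2 ⟨fun b _ => ?_, ?_⟩, ?_⟩
  · exact List.pairwise_map.2 (hlt.imp fun h => Or.inr ⟨rfl, Or.inr ⟨rfl, h⟩⟩)
  · refine hlt.imp fun h => ?_
    simp only [List.mem_map]
    rintro _ ⟨x, -, rfl⟩ _ ⟨y, -, rfl⟩
    exact Or.inr ⟨rfl, Or.inl h⟩
  · refine hlt.imp fun h => ?_
    simp only [List.mem_map, List.mem_flatMap]
    rintro _ ⟨_, -, x, -, rfl⟩ _ ⟨_, -, y, -, rfl⟩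
    exact Or.inl h

lemma mem_triplesLex (t : Fin n × Fin n × Fin n) : t ∈ triplesLex n := by
  simp [triplesLex]

lemma lexInitial_filter_triplesLex (m : Fin n) :
    LexInitial ((triplesLex n).filter fun t => decide (t.1 ≤ m)) := by
  intro A t B hL s hs
  have hp := (pairwise_lexLT_triplesLex (n := n)).filter fun t => decide (t.1 ≤ m)
  have ht : t ∈ (triplesLex n).filter fun t => decide (t.1 ≤ m) := by simp [hL]
  have htm : t.1 ≤ m := by simpa using (List.mem_filter.1 ht).2
  have hsL : s ∈ (triplesLex n).filter fun t => decide (t.1 ≤ m) := by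
    refine List.mem_filter.2 ⟨mem_triplesLex s, ?_⟩
    unfold LexLT at hs
    simp only [decide_eq_true_eq]
    omega
  rw [hL] at hp hsL
  rcases List.mem_append.1 hsL with h | h
  · exact h
  · exfalso
    have hp' := (List.pairwise_append.1 hp).2.1
    rcases List.mem_cons.1 h with rfl | h
    · unfold LexLT at hs
      omega
    · have := (List.pairwise_cons.1 hp').1 s h
      unfold LexLT at hs this
      omega

lemma upd_le (d : Fin n → Fin n → EReal) (i j k x y : Fin n) : upd d i j k x y ≤ d x y := by
  unfold upd
  split_ifs with h
  · rw [h.1, h.2]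
    exact min_le_left _ _
  · exact le_rfl

lemma foldIJK_le (L : List (Fin n × Fin n × Fin n)) (d : Fin n → Fin n → EReal) (x y : Fin n) :
    foldIJK L d x y ≤ d x y := by
  induction L generalizing d with
  | nil => exact le_rfl
  | cons t L ih => exact (ih _).trans (upd_le _ _ _ _ _ _)

lemma foldIJK_append (A B : List (Fin n × Fin n × Fin n)) (d : Fin n → Fin n → EReal) :
    foldIJK (A ++ B) d = foldIJK B (foldIJK A d) := by
  simp [foldIJK]

lemma foldIJK_append_cons_le (A B : List (Fin n × Fin n × Fin n)) (d : Fin n → Fin n → EReal)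
    (i j k : Fin n) :
    foldIJK (A ++ (i, j, k) :: B) d i j ≤ foldIJK A d i k + foldIJK A d k j := by
  rw [foldIJK_append]
  refine (foldIJK_le B (upd (foldIJK A d) i j k) i j).trans ?_
  simp [upd]

lemma walkLen_append_cons (d : Fin n → Fin n → EReal) (p q : List (Fin n)) (v : Fin n) :
    walkLen d (p ++ v :: q) = walkLen d (p ++ [v]) + walkLen d (v :: q) := by
  induction p with
  | nil => simp [walkLen]
  | cons x p ih =>
    cases p with
    | nil => simp [walkLen]
    | cons y p =>
      simp only [List.cons_append, walkLen] at ih ⊢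
      rw [ih, add_assoc]

/-- `d` assigns to every pair of vertices the `w`-length of some walk joining them. -/
def IsWalkLength (w d : Fin n → Fin n → EReal) : Prop :=
  ∀ i j, ∃ u : List (Fin n), u.head? = some i ∧ u.getLast? = some j ∧ walkLen w u = d i j

lemma isWalkLength_self (w : Fin n → Fin n → EReal) : IsWalkLength w w :=
  fun i j => ⟨[i, j], by simp [walkLen]⟩

lemma IsWalkLength.upd {w d : Fin n → Fin n → EReal} (h : IsWalkLength w d) (i j k : Fin n) :
    IsWalkLength w (upd d i j k) := by
  intro x y
  unfold _root_.upd
  split_ifs with hxy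
  · obtain ⟨rfl, rfl⟩ := hxy
    rcases min_choice (d x y) (d x k + d k y) with hm | hm
    · rw [hm]
      exact h x y
    · rw [hm]
      obtain ⟨p, hp, hp', hpl⟩ := h x k
      obtain ⟨q, hq, hq', hql⟩ := h k y
      obtain ⟨p, rfl⟩ := List.getLast?_eq_some_iff.1 hp'
      obtain ⟨q, rfl⟩ := List.head?_eq_some_iff.1 hq
      refine ⟨p ++ k :: q, ?_, ?_, ?_⟩
      · cases p <;> simpa using hp
      · simpa [List.getLast?_append] using hq'
      · rw [walkLen_append_cons, hpl, hql]
  · exact h x y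

lemma IsWalkLength.foldIJK {w d : Fin n → Fin n → EReal} (h : IsWalkLength w d)
    (L : List (Fin n × Fin n × Fin n)) : IsWalkLength w (foldIJK L d) := by
  induction L generalizing d with
  | nil => exact h
  | cons t L ih => exact ih (h.upd _ _ _)

lemma IsWalkLength.distW_le {w d : Fin n → Fin n → EReal} (h : IsWalkLength w d) (i j : Fin n) :
    distW w i j ≤ d i j :=
  sInf_le (h i j)

lemma NoNegCycle.distW_self_nonneg {w : Fin n → Fin n → EReal} (h : NoNegCycle w) (v : Fin n) :
    0 ≤ distW w v v := by
  refine le_sInf ?_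
  rintro _ ⟨p, hp, hp', rfl⟩
  exact h p v hp hp'

lemma pathLen_add (w : Fin n → Fin n → EReal) (u : ℕ → Fin n) {a b c : ℕ} (hab : a ≤ b)
    (hbc : b ≤ c) : pathLen w u a b + pathLen w u b c = pathLen w u a c :=
  Finset.sum_Ico_consecutive _ hab hbc

/-- Among the indices strictly between `a` and `c`, a first and a last index at which `u` attains
its maximum. -/
lemma exists_first_last_max (u : ℕ → Fin n) {a c : ℕ} (hac : a + 1 < c) :
    ∃ b₁ b₂, a < b₁ ∧ b₁ ≤ b₂ ∧ b₂ < c ∧ u b₁ = u b₂ ∧ (∀ x, a < x → x < b₁ → u x < u b₁) ∧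
      ∀ x, b₂ < x → x < c → u x < u b₂ := by
  obtain ⟨b, hb, hmax⟩ := (Finset.Ioo a c).exists_max_image u
    ⟨a + 1, Finset.mem_Ioo.2 ⟨a.lt_succ_self, hac⟩⟩
  have hne : ((Finset.Ioo a c).filter (u · = u b)).Nonempty :=
    ⟨b, Finset.mem_filter.2 ⟨hb, rfl⟩⟩
  obtain ⟨b₁, h₁, hmin₁⟩ := Finset.exists_min_image _ id hne
  obtain ⟨b₂, h₂, hmax₂⟩ := Finset.exists_max_image _ id hne
  simp only [Finset.mem_filter, Finset.mem_Ioo, id, and_imp] at *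
  refine ⟨b₁, b₂, h₁.1.1, hmin₁ b₂ h₂.1.1 h₂.1.2 h₂.2, h₂.1.2, h₁.2.trans h₂.2.symm, ?_, ?_⟩
  · intro x hax hx
    rw [h₁.2]
    refine lt_of_le_of_ne (hmax x hax (hx.trans h₁.1.2)) fun h => ?_
    exact absurd (hmin₁ x hax (hx.trans h₁.1.2) h) (by omega)
  · intro x hx hxc
    rw [h₂.2]
    refine lt_of_le_of_ne (hmax x (h₂.1.1.trans hx) hxc) fun h => ?_
    exact absurd (hmax₂ x (h₂.1.1.trans hx) hxc h) (by omega)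

/-- If all inner vertices of a subpath of a shortest path are smaller than both of its ends, then
its length is reached as soon as all triples for its pair of ends have been processed. -/
lemma foldIJK_le_pathLen {w : Fin n → Fin n → EReal} (hncyc : NoNegCycle w) {u : ℕ → Fin n} {l : ℕ}
    (hsp : IsShortestPath w u l) {L : List (Fin n × Fin n × Fin n)} (hL : LexInitial L) {a c : ℕ}
    (hac : a < c) (hcl : c ≤ l) (hmid : ∀ b, a < b → b < c → u b < u a ∧ u b < u c)
    (hmem : ∀ k, (u a, u c, k) ∈ L) : foldIJK L w (u a) (u c) ≤ pathLen w u a c := by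
  induction hk : c - a using Nat.strong_induction_on generalizing a c L with
  | _ k ih =>
    obtain rfl | hac' := (Nat.succ_le_of_lt hac).eq_or_lt
    · simpa [pathLen] using foldIJK_le L w (u a) (u (a + 1))
    obtain ⟨b₁, b₂, hab, hb, hbc, hu, hlt₁, hlt₂⟩ := exists_first_last_max u hac'
    have hb₁ := hmid b₁ hab (hb.trans_lt hbc)
    have hb₂ := hmid b₂ (hab.trans_le hb) hbc
    obtain ⟨A, B, rfl⟩ := List.append_of_mem (hmem (u b₂))
    have hA : LexInitial A := hL.of_append
    have hleft : foldIJK A w (u a) (u b₁) ≤ pathLen w u a b₁ :=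
      ih (b₁ - a) (by omega) hA hab (by omega)
        (fun x hx hx' => ⟨(hmid x hx (by omega)).1, hlt₁ x hx hx'⟩)
        (fun k => hL A _ B rfl _ (Or.inr ⟨rfl, Or.inl hb₁.2⟩)) rfl
    have hright : foldIJK A w (u b₂) (u c) ≤ pathLen w u b₂ c :=
      ih (c - b₂) (by omega) hA hbc hcl
        (fun x hx hx' => ⟨hlt₂ x hx hx', (hmid x (by omega) hx').2⟩)
        (fun k => hL A _ B rfl _ (Or.inl hb₂.1)) rfl
    have hcycle : 0 ≤ pathLen w u b₁ b₂ := by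
      rw [hsp b₁ b₂ hb (by omega), hu]
      exact hncyc.distW_self_nonneg _
    rw [hu] at hleft
    calc foldIJK (A ++ (u a, u c, u b₂) :: B) w (u a) (u c)
        ≤ foldIJK A w (u a) (u b₂) + foldIJK A w (u b₂) (u c) := foldIJK_append_cons_le ..
      _ ≤ pathLen w u a b₁ + pathLen w u b₂ c := add_le_add hleft hright
      _ ≤ pathLen w u a b₁ + pathLen w u b₁ b₂ + pathLen w u b₂ c := by
        gcongr
        exact le_add_of_nonneg_right hcycle
      _ = pathLen w u a c := by rw [pathLen_add w u hab.le hb, pathLen_add w u (by omega) hbc.le]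

end FoldIJK

/-- Lemma 1 of the paper. Let `u_0, …, u_l` be a shortest path and
let `a < c ≤ l` be such that `u_a > u_b` and `u_c > u_b` for all `a < b < c`. Then after
the partial run of the IJK algorithm (started from `d = w`) consisting of all outer-loop
iterations `i ≤ u_a`, the entry at `(u_a, u_c)` equals the shortest path distance. -/
theorem lemma1_ijk_dent (n : ℕ) (hn : 1 ≤ n)
    (w : Fin n → Fin n → EReal) (hw : ∀ i j, w i j ≠ ⊥) (hncyc : NoNegCycle w)
    (u : ℕ → Fin n) (l : ℕ) (hsp : IsShortestPath w u l)
    (a c : ℕ) (hac : a < c) (hcl : c ≤ l)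
    (hmid : ∀ b, a < b → b < c → u b < u a ∧ u b < u c) :
    runIJKUpto (u a) w (u a) (u c) = distW w (u a) (u c) := by
  refine le_antisymm ?_ (((isWalkLength_self w).foldIJK _).distW_le _ _)
  rw [← hsp a c hac.le hcl]
  exact foldIJK_le_pathLen hncyc hsp (lexInitial_filter_triplesLex (u a)) hac hcl hmid fun k =>
    List.mem_filter.2 ⟨mem_triplesLex _, by simp⟩
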